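/- Let (q_n)_{n≥1} be a sequence of reals with 0 < q_n ≤ 1 for all n. If the sequence (1/[n−1]_{q_n})_{n≥3} is Abel null, then for every f ∈ C[0,1] the series Σ_{n=1}^∞ (M_n^{q_n}(f)(x) − f(x)) yⁿ converges for every x ∈ [0,1] and y ∈ (0,1), and lim_{y→1⁻} (1−y) · sup_{0≤x≤1} |Σ_{n=1}^∞ (M_n^{q_n}(f)(x) − f(x)) yⁿ| = 0. -/

import Mathlib

open Filter Topology

/-- The `q`-integer `[n]_q = 1 + q + ⋯ + q^{n-1}`. -/
noncomputable def qInt (q : ℝ) (n : ℕ) : ℝ := ∑ k ∈ Finset.range n, q ^ k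

/-- The `q`-factorial `[n]_q!`. -/
noncomputable def qFact (q : ℝ) (n : ℕ) : ℝ := ∏ k ∈ Finset.range n, qInt q (k + 1)

/-- The `q`-binomial coefficient `[m choose r]_q`. -/
noncomputable def qBinom (q : ℝ) (m r : ℕ) : ℝ := qFact q m / (qFact q r * qFact q (m - r))

/-- The `q`-Meyer–König–Zeller operator. -/
noncomputable def MKZ (q : ℝ) (n : ℕ) (f : ℝ → ℝ) (x : ℝ) : ℝ :=
  if x = 1 then f 1
  else (∏ j ∈ Finset.range (n + 1), (1 - q ^ j * x)) *
    ∑' k : ℕ, f (qInt q k / qInt q (n + k)) * qBinom q (n + k) k * x ^ k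
theorem qInt_succ (q : ℝ) (n : ℕ) : qInt q (n + 1) = qInt q n + q ^ n :=
  Finset.sum_range_succ _ _

theorem qInt_succ' (q : ℝ) (n : ℕ) : qInt q (n + 1) = 1 + q * qInt q n := by
  simp only [qInt, Finset.sum_range_succ', Finset.mul_sum, pow_succ', pow_zero]
  ring

theorem qInt_add (q : ℝ) (m k : ℕ) : qInt q (m + k) = qInt q m + q ^ m * qInt q k := by
  simp only [qInt, Finset.sum_range_add, Finset.mul_sum, pow_add]

theorem qInt_nonneg {q : ℝ} (hq : 0 < q) (n : ℕ) : 0 ≤ qInt q n :=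
  Finset.sum_nonneg fun _ _ => by positivity

theorem qInt_mono {q : ℝ} (hq : 0 < q) : Monotone (qInt q) :=
  monotone_nat_of_le_succ fun n => by
    rw [qInt_succ]
    linarith [pow_pos hq n]

theorem one_le_qInt {q : ℝ} (hq : 0 < q) {n : ℕ} (hn : 1 ≤ n) : 1 ≤ qInt q n := by
  have h := qInt_mono hq hn
  simpa [qInt] using h

theorem qInt_pos {q : ℝ} (hq : 0 < q) {n : ℕ} (hn : 1 ≤ n) : 0 < qInt q n :=
  one_pos.trans_le (one_le_qInt hq hn)

theorem qFact_succ (q : ℝ) (n : ℕ) : qFact q (n + 1) = qFact q n * qInt q (n + 1) :=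
  Finset.prod_range_succ _ _

theorem qFact_zero (q : ℝ) : qFact q 0 = 1 :=
  Finset.prod_range_zero _

theorem qFact_pos {q : ℝ} (hq : 0 < q) (n : ℕ) : 0 < qFact q n :=
  Finset.prod_pos fun k _ => qInt_pos hq (by omega)

theorem qBinom_add_right (q : ℝ) (n k : ℕ) :
    qBinom q (n + k) k = qFact q (n + k) / (qFact q k * qFact q n) := by
  rw [qBinom, add_tsub_cancel_right]

theorem qBinom_pos {q : ℝ} (hq : 0 < q) (m r : ℕ) : 0 < qBinom q m r :=
  div_pos (qFact_pos hq _) (mul_pos (qFact_pos hq _) (qFact_pos hq _))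

theorem qBinom_zero_right {q : ℝ} (hq : 0 < q) (n : ℕ) : qBinom q n 0 = 1 := by
  rw [qBinom, qFact_zero, one_mul, tsub_zero, div_self (qFact_pos hq n).ne']

theorem qBinom_self {q : ℝ} (hq : 0 < q) (n : ℕ) : qBinom q n n = 1 := by
  rw [qBinom, tsub_self, qFact_zero, mul_one, div_self (qFact_pos hq n).ne']

/-- The `q`-Pascal rule. -/
theorem qBinom_pascal {q : ℝ} (hq : 0 < q) (n k : ℕ) :
    qBinom q (n + 1 + (k + 1)) (k + 1) =
      q ^ (n + 1) * qBinom q (n + 1 + k) k + qBinom q (n + (k + 1)) (k + 1) := by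
  rw [qBinom_add_right, qBinom_add_right, qBinom_add_right,
    show n + 1 + (k + 1) = n + 1 + k + 1 by ring, show n + (k + 1) = n + 1 + k by ring,
    qFact_succ q (n + 1 + k), qFact_succ q k, qFact_succ q n,
    show n + 1 + k + 1 = n + 1 + (k + 1) by ring, qInt_add q (n + 1) (k + 1)]
  have h1 := (qFact_pos hq n).ne'
  have h2 := (qFact_pos hq k).ne'
  have h3 := (qInt_pos hq (n := n + 1) (by omega)).ne'
  have h4 := (qInt_pos hq (n := k + 1) (by omega)).ne'
  field_simp
  ring

theorem qInt_div_mul_qBinom {q : ℝ} (hq : 0 < q) (n k : ℕ) :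
    qInt q (k + 1) / qInt q (n + (k + 1)) * qBinom q (n + (k + 1)) (k + 1) =
      qBinom q (n + k) k := by
  rw [qBinom_add_right, qBinom_add_right, ← add_assoc, qFact_succ q (n + k), qFact_succ q k]
  have h1 := (qFact_pos hq n).ne'
  have h2 := (qFact_pos hq k).ne'
  have h3 := (qInt_pos hq (n := n + k + 1) (by omega)).ne'
  have h4 := (qInt_pos hq (n := k + 1) (by omega)).ne'
  field_simp

theorem qInt_div_mem_Icc {q : ℝ} (hq : 0 < q) (n k : ℕ) :
    qInt q k / qInt q (n + k) ∈ Set.Icc (0 : ℝ) 1 :=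
  ⟨div_nonneg (qInt_nonneg hq _) (qInt_nonneg hq _),
    div_le_one_of_le₀ (qInt_mono hq (by omega)) (qInt_nonneg hq _)⟩

theorem qInt_div_succ_le {q : ℝ} (hq : 0 < q) (hq1 : q ≤ 1) {n : ℕ} (hn : 1 ≤ n) (k : ℕ) :
    qInt q (k + 1) / qInt q (n + (k + 1)) ≤
      1 / qInt q (n + 1) + qInt q k / qInt q (n + k) := by
  have hk := qInt_nonneg hq k
  calc qInt q (k + 1) / qInt q (n + (k + 1))
      ≤ (1 + qInt q k) / qInt q (n + (k + 1)) := by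
        refine div_le_div_of_nonneg_right ?_ (qInt_nonneg hq _)
        rw [qInt_succ']
        nlinarith
    _ = 1 / qInt q (n + (k + 1)) + qInt q k / qInt q (n + (k + 1)) := add_div _ _ _
    _ ≤ _ := add_le_add
        (div_le_div_of_nonneg_left zero_le_one (qInt_pos hq (by omega)) (qInt_mono hq (by omega)))
        (div_le_div_of_nonneg_left hk (qInt_pos hq (by omega)) (qInt_mono hq (by omega)))

section Weights

variable {q x : ℝ}

theorem one_sub_pow_mul_pos (hq : 0 < q) (hq1 : q ≤ 1) (hx0 : 0 ≤ x) (hx1 : x < 1) (j : ℕ) :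
    0 < 1 - q ^ j * x := by
  have := mul_le_mul_of_nonneg_right (pow_le_one₀ (n := j) hq.le hq1) hx0
  linarith

theorem summable_qBinom_mul_pow (hq : 0 < q) (hq1 : q ≤ 1) (hx0 : 0 ≤ x) (hx1 : x < 1) (n : ℕ) :
    Summable fun k : ℕ => qBinom q (n + k) k * x ^ k := by
  have hnn : ∀ n k : ℕ, 0 ≤ qBinom q (n + k) k * x ^ k := fun n k =>
    mul_nonneg (qBinom_pos hq _ _).le (pow_nonneg hx0 k)
  induction n with
  | zero =>
    refine (summable_geometric_of_lt_one hx0 hx1).congr fun k => ?_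
    rw [zero_add, qBinom_self hq, one_mul]
  | succ n ih =>
    refine summable_of_sum_range_le (c := (∑' k : ℕ, qBinom q (n + k) k * x ^ k) / (1 - x))
      (hnn (n + 1)) fun N => ?_
    rw [le_div_iff₀ (by linarith)]
    have hrec : ∑ k ∈ Finset.range (N + 1), qBinom q (n + 1 + k) k * x ^ k =
        q ^ (n + 1) * x * ∑ k ∈ Finset.range N, qBinom q (n + 1 + k) k * x ^ k +
          ∑ k ∈ Finset.range (N + 1), qBinom q (n + k) k * x ^ k := by
      rw [Finset.sum_range_succ', Finset.sum_range_succ' _ N, Finset.mul_sum, ← add_assoc,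
        ← Finset.sum_add_distrib]
      simp only [add_zero, qBinom_zero_right hq, qBinom_pascal hq]
      congr 1
      refine Finset.sum_congr rfl fun k _ => ?_
      ring
    have hmono : ∑ k ∈ Finset.range N, qBinom q (n + 1 + k) k * x ^ k ≤
        ∑ k ∈ Finset.range (N + 1), qBinom q (n + 1 + k) k * x ^ k := by
      rw [Finset.sum_range_succ]
      linarith [hnn (n + 1) N]
    have hle := ih.sum_le_tsum (Finset.range (N + 1)) fun k _ => hnn n k
    have hT := Finset.sum_nonneg fun k (_ : k ∈ Finset.range N) => hnn (n + 1) k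
    have hp : q ^ (n + 1) * x ≤ x := mul_le_of_le_one_left hx0 (pow_le_one₀ hq.le hq1)
    have := mul_le_mul_of_nonneg_right hp hT
    linarith

theorem prod_mul_tsum_qBinom (hq : 0 < q) (hq1 : q ≤ 1) (hx0 : 0 ≤ x) (hx1 : x < 1) (n : ℕ) :
    (∏ j ∈ Finset.range (n + 1), (1 - q ^ j * x)) *
      ∑' k : ℕ, qBinom q (n + k) k * x ^ k = 1 := by
  induction n with
  | zero =>
    have h : ∀ k : ℕ, qBinom q (0 + k) k * x ^ k = x ^ k := fun k => by
      rw [zero_add, qBinom_self hq, one_mul]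
    simp only [h, tsum_geometric_of_lt_one hx0 hx1]
    simp [(sub_pos.2 hx1).ne']
  | succ n ih =>
    have hs := summable_qBinom_mul_pow hq hq1 hx0 hx1 (n + 1)
    have hs' := summable_qBinom_mul_pow hq hq1 hx0 hx1 n
    have hrec : (1 - q ^ (n + 1) * x) * ∑' k : ℕ, qBinom q (n + 1 + k) k * x ^ k =
        ∑' k : ℕ, qBinom q (n + k) k * x ^ k := by
      have h1 : ∑' k : ℕ, qBinom q (n + 1 + k) k * x ^ k =
          q ^ (n + 1) * x * (∑' k : ℕ, qBinom q (n + 1 + k) k * x ^ k) +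
            ∑' k : ℕ, qBinom q (n + k) k * x ^ k := by
        rw [← tsum_mul_left, hs'.tsum_eq_zero_add, add_left_comm,
          ← (hs.mul_left _).tsum_add ((summable_nat_add_iff 1).2 hs')]
        nth_rewrite 1 [hs.tsum_eq_zero_add]
        simp only [add_zero, qBinom_zero_right hq, qBinom_pascal hq]
        congr 1
        refine tsum_congr fun k => ?_
        ring
      linarith
    rw [Finset.prod_range_succ, mul_assoc, hrec, ih]

/-- The weights of the `q`-Meyer–König–Zeller operator. -/
noncomputable def mkzWeight (q : ℝ) (n : ℕ) (x : ℝ) (k : ℕ) : ℝ :=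
  (∏ j ∈ Finset.range (n + 1), (1 - q ^ j * x)) * (qBinom q (n + k) k * x ^ k)

theorem mkzWeight_nonneg (hq : 0 < q) (hq1 : q ≤ 1) (hx0 : 0 ≤ x) (hx1 : x < 1) (n k : ℕ) :
    0 ≤ mkzWeight q n x k :=
  mul_nonneg (Finset.prod_nonneg fun j _ => (one_sub_pow_mul_pos hq hq1 hx0 hx1 j).le)
    (mul_nonneg (qBinom_pos hq _ _).le (pow_nonneg hx0 k))

theorem hasSum_mkzWeight (hq : 0 < q) (hq1 : q ≤ 1) (hx0 : 0 ≤ x) (hx1 : x < 1) (n : ℕ) :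
    HasSum (mkzWeight q n x) 1 := by
  rw [← prod_mul_tsum_qBinom hq hq1 hx0 hx1 n]
  exact (summable_qBinom_mul_pow hq hq1 hx0 hx1 n).hasSum.mul_left _

theorem MKZ_eq_tsum (hx1 : x < 1) (n : ℕ) (f : ℝ → ℝ) :
    MKZ q n f x = ∑' k : ℕ, f (qInt q k / qInt q (n + k)) * mkzWeight q n x k := by
  rw [MKZ, if_neg hx1.ne, ← tsum_mul_left]
  refine tsum_congr fun k => ?_
  rw [mkzWeight]
  ring

theorem qInt_div_mul_mkzWeight (hq : 0 < q) (n k : ℕ) :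
    qInt q (k + 1) / qInt q (n + (k + 1)) * mkzWeight q n x (k + 1) = x * mkzWeight q n x k := by
  rw [mkzWeight, mkzWeight, ← qInt_div_mul_qBinom hq n k]
  ring

theorem summable_mul_mkzWeight (hq : 0 < q) (hq1 : q ≤ 1) (hx0 : 0 ≤ x) (hx1 : x < 1) (n : ℕ)
    {g : ℕ → ℝ} {C : ℝ} (hg : ∀ k, |g k| ≤ C) : Summable fun k => g k * mkzWeight q n x k := by
  refine Summable.of_norm_bounded ((hasSum_mkzWeight hq hq1 hx0 hx1 n).summable.mul_left C)
    fun k => ?_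
  have hw := mkzWeight_nonneg hq hq1 hx0 hx1 n k
  rw [norm_mul, Real.norm_eq_abs, Real.norm_eq_abs, abs_of_nonneg hw]
  exact mul_le_mul_of_nonneg_right (hg k) hw

theorem abs_qInt_div_le_one (hq : 0 < q) (n k : ℕ) : |qInt q k / qInt q (n + k)| ≤ 1 := by
  have h := qInt_div_mem_Icc hq n k
  rw [abs_of_nonneg h.1]
  exact h.2

theorem hasSum_qInt_div_mul_mkzWeight (hq : 0 < q) (hq1 : q ≤ 1) (hx0 : 0 ≤ x) (hx1 : x < 1)
    (n : ℕ) : HasSum (fun k => qInt q k / qInt q (n + k) * mkzWeight q n x k) x := by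
  have hs := summable_mul_mkzWeight hq hq1 hx0 hx1 n (abs_qInt_div_le_one hq n)
  have h : ∑' k, qInt q k / qInt q (n + k) * mkzWeight q n x k = x := by
    rw [hs.tsum_eq_zero_add]
    simp only [qInt_div_mul_mkzWeight hq, tsum_mul_left,
      (hasSum_mkzWeight hq hq1 hx0 hx1 n).tsum_eq]
    simp [qInt]
  exact hs.hasSum_iff.2 h

theorem tsum_qInt_div_sq_mul_mkzWeight_le (hq : 0 < q) (hq1 : q ≤ 1) (hx0 : 0 ≤ x) (hx1 : x < 1)
    {n : ℕ} (hn : 1 ≤ n) :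
    ∑' k, (qInt q k / qInt q (n + k)) ^ 2 * mkzWeight q n x k ≤
      x ^ 2 + 1 / qInt q (n + 1) := by
  have hs : Summable fun k => (qInt q k / qInt q (n + k)) ^ 2 * mkzWeight q n x k :=
    summable_mul_mkzWeight hq hq1 hx0 hx1 n (C := 1) fun k => by
      rw [abs_pow]
      exact pow_le_one₀ (abs_nonneg _) (abs_qInt_div_le_one hq n k)
  have hc : 0 ≤ 1 / qInt q (n + 1) := one_div_nonneg.2 (qInt_nonneg hq _)
  have hrhs : HasSum (fun k => x * (1 / qInt q (n + 1) * mkzWeight q n x k +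
      qInt q k / qInt q (n + k) * mkzWeight q n x k)) (x * (1 / qInt q (n + 1) * 1 + x)) :=
    (((hasSum_mkzWeight hq hq1 hx0 hx1 n).mul_left _).add
      (hasSum_qInt_div_mul_mkzWeight hq hq1 hx0 hx1 n)).mul_left x
  have hle : ∑' k, (qInt q (k + 1) / qInt q (n + (k + 1))) ^ 2 * mkzWeight q n x (k + 1) ≤
      x * (1 / qInt q (n + 1) * 1 + x) := by
    rw [← hrhs.tsum_eq]
    refine ((summable_nat_add_iff 1).2 hs).tsum_le_tsum (fun k => ?_) hrhs.summable
    rw [sq, mul_assoc, qInt_div_mul_mkzWeight hq, ← add_mul, mul_left_comm]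
    exact mul_le_mul_of_nonneg_left (mul_le_mul_of_nonneg_right (qInt_div_succ_le hq hq1 hn k)
      (mkzWeight_nonneg hq hq1 hx0 hx1 n k)) hx0
  rw [hs.tsum_eq_zero_add]
  have h0 : (qInt q 0 / qInt q (n + 0)) ^ 2 * mkzWeight q n x 0 = 0 := by simp [qInt]
  rw [h0]
  nlinarith

theorem tsum_sub_sq_mul_mkzWeight_le (hq : 0 < q) (hq1 : q ≤ 1) (hx0 : 0 ≤ x) (hx1 : x < 1)
    {n : ℕ} (hn : 1 ≤ n) :
    ∑' k, (qInt q k / qInt q (n + k) - x) ^ 2 * mkzWeight q n x k ≤ 1 / qInt q (n + 1) := by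
  have hs : Summable fun k => (qInt q k / qInt q (n + k)) ^ 2 * mkzWeight q n x k :=
    summable_mul_mkzWeight hq hq1 hx0 hx1 n (C := 1) fun k => by
      rw [abs_pow]
      exact pow_le_one₀ (abs_nonneg _) (abs_qInt_div_le_one hq n k)
  have h := (hs.hasSum.sub ((hasSum_qInt_div_mul_mkzWeight hq hq1 hx0 hx1 n).mul_left (2 * x))).add
    ((hasSum_mkzWeight hq hq1 hx0 hx1 n).mul_left (x ^ 2))
  have hcongr : (fun k => (qInt q k / qInt q (n + k) - x) ^ 2 * mkzWeight q n x k) = fun k =>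
      (qInt q k / qInt q (n + k)) ^ 2 * mkzWeight q n x k -
        2 * x * (qInt q k / qInt q (n + k) * mkzWeight q n x k) +
        x ^ 2 * mkzWeight q n x k := by
    funext k
    ring
  rw [hcongr, h.tsum_eq]
  linarith [tsum_qInt_div_sq_mul_mkzWeight_le hq hq1 hx0 hx1 hn]

end Weights

/-- A modulus-of-continuity bound yields a pointwise estimate for the operator. -/
theorem abs_MKZ_sub_le {q : ℝ} (hq : 0 < q) (hq1 : q ≤ 1) {f : ℝ → ℝ} {ε K : ℝ} (hε : 0 ≤ ε)
    (hK : 0 ≤ K)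
    (hf : ∀ s ∈ Set.Icc (0 : ℝ) 1, ∀ t ∈ Set.Icc (0 : ℝ) 1, |f s - f t| ≤ ε + K * (s - t) ^ 2)
    {n : ℕ} (hn : 1 ≤ n) {x : ℝ} (hx : x ∈ Set.Icc (0 : ℝ) 1) :
    |MKZ q n f x - f x| ≤ ε + K * (1 / qInt q (n + 1)) := by
  obtain ⟨hx0, hx1⟩ := hx
  rcases hx1.eq_or_lt with rfl | hx1
  · have : 0 ≤ 1 / qInt q (n + 1) := one_div_nonneg.2 (qInt_nonneg hq _)
    simp only [MKZ, if_true, sub_self, abs_zero]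
    positivity
  have hw := hasSum_mkzWeight hq hq1 hx0 hx1 n
  have hdist : ∀ k, (qInt q k / qInt q (n + k) - x) ^ 2 ≤ 1 := fun k => by
    have h := qInt_div_mem_Icc hq n k
    rw [sq_le_one_iff_abs_le_one, abs_le]
    exact ⟨by linarith [h.1], by linarith [h.2]⟩
  have hb : ∀ k, |f (qInt q k / qInt q (n + k)) - f x| ≤
      ε + K * (qInt q k / qInt q (n + k) - x) ^ 2 := fun k =>
    hf _ (qInt_div_mem_Icc hq n k) _ ⟨hx0, hx1.le⟩
  have hs1 : Summable fun k => (f (qInt q k / qInt q (n + k)) - f x) * mkzWeight q n x k :=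
    summable_mul_mkzWeight hq hq1 hx0 hx1 n (C := ε + K * 1) fun k =>
      (hb k).trans (by gcongr; exact hdist k)
  have hs2 : Summable fun k => (qInt q k / qInt q (n + k) - x) ^ 2 * mkzWeight q n x k :=
    summable_mul_mkzWeight hq hq1 hx0 hx1 n (C := 1) fun k => by
      rw [abs_of_nonneg (sq_nonneg _)]
      exact hdist k
  have heq : MKZ q n f x - f x =
      ∑' k, (f (qInt q k / qInt q (n + k)) - f x) * mkzWeight q n x k := by
    have h := hs1.hasSum.add (hw.mul_left (f x))
    have hcongr : (fun k => f (qInt q k / qInt q (n + k)) * mkzWeight q n x k) = fun k =>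
        (f (qInt q k / qInt q (n + k)) - f x) * mkzWeight q n x k +
          f x * mkzWeight q n x k := by
      funext k
      ring
    rw [MKZ_eq_tsum hx1, hcongr, h.tsum_eq]
    ring
  have hmaj := (hw.mul_left ε).add (hs2.hasSum.mul_left K)
  have hbound := tsum_of_norm_bounded hmaj (f := fun k =>
    (f (qInt q k / qInt q (n + k)) - f x) * mkzWeight q n x k) fun k => by
      have h0 := mkzWeight_nonneg hq hq1 hx0 hx1 n k
      rw [norm_mul, Real.norm_eq_abs, Real.norm_eq_abs, abs_of_nonneg h0, ← mul_assoc, ← add_mul]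
      exact mul_le_mul_of_nonneg_right (hb k) h0
  rw [heq, ← Real.norm_eq_abs]
  refine hbound.trans ?_
  have := mul_le_mul_of_nonneg_left (tsum_sub_sq_mul_mkzWeight_le hq hq1 hx0 hx1 hn) hK
  linarith

theorem exists_abs_sub_le_add_sq {f : ℝ → ℝ} {s : Set ℝ} (hs : IsCompact s)
    (hf : ContinuousOn f s) {ε : ℝ} (hε : 0 < ε) :
    ∃ K, 0 ≤ K ∧ ∀ a ∈ s, ∀ b ∈ s, |f a - f b| ≤ ε + K * (a - b) ^ 2 := by
  obtain ⟨C, hC⟩ := hs.exists_bound_of_continuousOn hf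
  obtain ⟨δ, hδ, hδf⟩ :=
    Metric.uniformContinuousOn_iff.1 (hs.uniformContinuousOn_of_continuous hf) ε hε
  refine ⟨2 * |C| / δ ^ 2, by positivity, fun a ha b hb => ?_⟩
  rcases lt_or_ge (dist a b) δ with h | h
  · have h1 := (hδf a ha b hb h).le
    rw [Real.dist_eq] at h1
    have : 0 ≤ 2 * |C| / δ ^ 2 * (a - b) ^ 2 := by positivity
    linarith
  · have h1 : |f a - f b| ≤ 2 * |C| := by
      have ha' := hC a ha
      have hb' := hC b hb
      rw [Real.norm_eq_abs] at ha' hb'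
      linarith [abs_sub (f a) (f b), le_abs_self C]
    have h2 : δ ^ 2 ≤ (a - b) ^ 2 := by
      rw [← sq_abs (a - b), ← Real.dist_eq]
      gcongr
    have h3 : 2 * |C| ≤ 2 * |C| / δ ^ 2 * (a - b) ^ 2 := by
      rw [div_mul_eq_mul_div, le_div_iff₀ (by positivity)]
      gcongr
    linarith

theorem stmt8 (q : ℕ → ℝ) (hq : ∀ n : ℕ, 1 ≤ n → 0 < q n ∧ q n ≤ 1)
    -- the sequence `(1/[n-1]_{q_n})_{n ≥ 3}` is Abel null
    (habel :
      (∀ y ∈ Set.Ioo (0 : ℝ) 1,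
        Summable (fun n : ℕ => (1 / qInt (q (n + 3)) (n + 2)) * y ^ (n + 3))) ∧
      Tendsto (fun y : ℝ => (1 - y) * ∑' n : ℕ, (1 / qInt (q (n + 3)) (n + 2)) * y ^ (n + 3))
        (𝓝[<] 1) (𝓝 0))
    (f : ℝ → ℝ) (hf : ContinuousOn f (Set.Icc 0 1)) :
    (∀ y ∈ Set.Ioo (0 : ℝ) 1, ∀ x ∈ Set.Icc (0 : ℝ) 1,
      Summable (fun n : ℕ => (MKZ (q (n + 1)) (n + 1) f x - f x) * y ^ (n + 1))) ∧
    Tendsto (fun y : ℝ =>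
        (1 - y) * ⨆ x : Set.Icc (0 : ℝ) 1,
          |∑' n : ℕ, (MKZ (q (n + 1)) (n + 1) f x - f x) * y ^ (n + 1)|)
      (𝓝[<] 1) (𝓝 0) := by
  have hc0 : ∀ n : ℕ, 0 ≤ 1 / qInt (q (n + 1)) (n + 1 + 1) := fun n =>
    one_div_nonneg.2 (qInt_nonneg (hq (n + 1) (by omega)).1 _)
  have hc1 : ∀ n : ℕ, 1 / qInt (q (n + 1)) (n + 1 + 1) ≤ 1 := fun n =>
    div_le_one_of_le₀ (one_le_qInt (hq (n + 1) (by omega)).1 (by omega))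
      (qInt_nonneg (hq (n + 1) (by omega)).1 _)
  have hgeom : ∀ y ∈ Set.Ioo (0 : ℝ) 1, HasSum (fun n : ℕ => y ^ (n + 1)) (y * (1 - y)⁻¹) :=
    fun y hy => by
      simpa only [pow_succ'] using (hasSum_geometric_of_lt_one hy.1.le hy.2).mul_left y
  have hcs : ∀ y ∈ Set.Ioo (0 : ℝ) 1,
      Summable fun n : ℕ => 1 / qInt (q (n + 1)) (n + 1 + 1) * y ^ (n + 1) := fun y hy =>
    Summable.of_nonneg_of_le (fun n => mul_nonneg (hc0 n) (pow_nonneg hy.1.le _))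
      (fun n => mul_le_of_le_one_left (pow_nonneg hy.1.le _) (hc1 n)) (hgeom y hy).summable
  have hct : ∀ y ∈ Set.Ioo (0 : ℝ) 1,
      ∑' n : ℕ, 1 / qInt (q (n + 1)) (n + 1 + 1) * y ^ (n + 1) ≤
        2 + ∑' n : ℕ, (1 / qInt (q (n + 3)) (n + 2)) * y ^ (n + 3) := fun y hy => by
    rw [← (hcs y hy).sum_add_tsum_nat_add 2]
    refine add_le_add ?_ ?_
    · have hterm : ∀ n : ℕ, 1 / qInt (q (n + 1)) (n + 1 + 1) * y ^ (n + 1) ≤ 1 := fun n =>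
        mul_le_one₀ (hc1 n) (pow_nonneg hy.1.le _) (pow_le_one₀ hy.1.le hy.2.le)
      refine (Finset.sum_le_sum fun n _ => hterm n).trans ?_
      norm_num
    · refine ((summable_nat_add_iff 2).2 (hcs y hy)).tsum_le_tsum (fun n => ?_) (habel.1 y hy)
      have hqn := (hq (n + 3) (by omega)).1
      exact mul_le_mul_of_nonneg_right
        (one_div_le_one_div_of_le (qInt_pos hqn (by omega)) (qInt_mono hqn (by omega)))
        (pow_nonneg hy.1.le _)
  have hsum : ∀ ε K : ℝ, ∀ y ∈ Set.Ioo (0 : ℝ) 1,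
      HasSum (fun n : ℕ => (ε + K * (1 / qInt (q (n + 1)) (n + 1 + 1))) * y ^ (n + 1))
        (ε * (y * (1 - y)⁻¹) +
          K * ∑' n : ℕ, 1 / qInt (q (n + 1)) (n + 1 + 1) * y ^ (n + 1)) := fun ε K y hy => by
    simpa only [add_mul, mul_assoc] using
      ((hgeom y hy).mul_left ε).add ((hcs y hy).hasSum.mul_left K)
  have hbd : ∀ ε : ℝ, 0 < ε → ∃ K, 0 ≤ K ∧ ∀ y ∈ Set.Ioo (0 : ℝ) 1, ∀ x ∈ Set.Icc (0 : ℝ) 1,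
      ∀ n : ℕ, ‖(MKZ (q (n + 1)) (n + 1) f x - f x) * y ^ (n + 1)‖ ≤
        (ε + K * (1 / qInt (q (n + 1)) (n + 1 + 1))) * y ^ (n + 1) := fun ε hε => by
    obtain ⟨K, hK, hKf⟩ := exists_abs_sub_le_add_sq isCompact_Icc hf hε
    refine ⟨K, hK, fun y hy x hx n => ?_⟩
    have hqn := hq (n + 1) (by omega)
    have hy' := pow_nonneg hy.1.le (n + 1)
    rw [norm_mul, Real.norm_eq_abs, Real.norm_eq_abs, abs_of_nonneg hy']
    exact mul_le_mul_of_nonneg_right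
      (abs_MKZ_sub_le hqn.1 hqn.2 hε.le hK hKf (by omega) hx) hy'
  constructor
  · intro y hy x hx
    obtain ⟨K, -, h⟩ := hbd 1 one_pos
    exact Summable.of_norm_bounded (hsum 1 K y hy).summable (h y hy x hx)
  have hIoo : ∀ᶠ y in 𝓝[<] (1 : ℝ), y ∈ Set.Ioo (0 : ℝ) 1 := Ioo_mem_nhdsLT one_pos
  rw [Metric.tendsto_nhds]
  intro ε hε
  obtain ⟨K, hK, h⟩ := hbd (ε / 2) (half_pos hε)
  have hlim : Tendsto (fun y : ℝ => K * ((1 - y) * 2 +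
      (1 - y) * ∑' n : ℕ, (1 / qInt (q (n + 3)) (n + 2)) * y ^ (n + 3))) (𝓝[<] 1) (𝓝 0) := by
    have h1 : Tendsto (fun y : ℝ => (1 - y) * 2) (𝓝[<] 1) (𝓝 0) := by
      have : Continuous fun y : ℝ => (1 - y) * 2 := by fun_prop
      simpa using (this.tendsto 1).mono_left nhdsWithin_le_nhds
    simpa using (h1.add habel.2).const_mul K
  filter_upwards [hIoo, hlim.eventually (gt_mem_nhds (half_pos hε))] with y hy hy2
  have h1y : 0 < 1 - y := sub_pos.2 hy.2
  have hsup : (⨆ x : Set.Icc (0 : ℝ) 1,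
      |∑' n : ℕ, (MKZ (q (n + 1)) (n + 1) f x - f x) * y ^ (n + 1)|) ≤
      ε / 2 * (y * (1 - y)⁻¹) +
        K * ∑' n : ℕ, 1 / qInt (q (n + 1)) (n + 1 + 1) * y ^ (n + 1) :=
    ciSup_le fun x => tsum_of_norm_bounded (hsum (ε / 2) K y hy) (h y hy x x.2)
  have hnn : 0 ≤ ⨆ x : Set.Icc (0 : ℝ) 1,
      |∑' n : ℕ, (MKZ (q (n + 1)) (n + 1) f x - f x) * y ^ (n + 1)| :=
    Real.iSup_nonneg fun _ => abs_nonneg _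
  rw [Real.dist_0_eq_abs, abs_of_nonneg (mul_nonneg h1y.le hnn)]
  calc _ ≤ (1 - y) * (ε / 2 * (y * (1 - y)⁻¹) +
        K * (2 + ∑' n : ℕ, (1 / qInt (q (n + 3)) (n + 2)) * y ^ (n + 3))) := by
        gcongr
        exact hsup.trans (by gcongr; exact hct y hy)
    _ = ε / 2 * y + K * ((1 - y) * 2 +
          (1 - y) * ∑' n : ℕ, (1 / qInt (q (n + 3)) (n + 2)) * y ^ (n + 3)) := by
        have : (1 - y) * (ε / 2 * (y * (1 - y)⁻¹)) = ε / 2 * y := by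
          field_simp
        rw [mul_add, this]
        ring
    _ < ε := by nlinarith [hy.2]
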